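/- (Theorem 1.) Let $n, m \ge 0$ be integers. A state of a system of $n$ spins is a subset $S$ of the set of spins (those in state $1$), and its weight is $|S|$. Let $H$ be a real-valued function on states that is an $m$-body Hamiltonian, i.e. there are real coefficients $c(T)$, indexed by the states $T$, with $c(T) = 0$ whenever $|T| > m$ and $H(S) = \sum_{T \subseteq S} c(T)$ for every state $S$. Assume that $H(S) \ge 0$ for every state $S$ and that $H(\emptyset) = 0$, and let $G = \{S : H(S) = 0\}$ be its set of ground states. Fix any state $b$ with $|b| > m$, and define $A = \{b\} \cup \{d \subseteq b : 1 \le |d| \le m-1 \text{ and } |d| \equiv m-1 \pmod 2\}$ and $B = \{d \subseteq b : 1 \le |d| \le m \text{ and } |d| \equiv m \pmod 2\}$. Then $A \subseteq G$ if and only if $B \subseteq G$. -/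

import Mathlib

/-- The coefficients `c` represent the Hamiltonian `H`: a state is the set of spins in state `1`,
so the monomial of `T` takes the value `1` on `S` if `T ⊆ S`, and `0` otherwise. -/
def Represents {n : ℕ} (c H : Finset (Fin n) → ℝ) : Prop :=
  ∀ S : Finset (Fin n), H S = ∑ T ∈ S.powerset, c T

/-- `H` has no interaction of more than `m` spins. -/
def IsBody {n : ℕ} (m : ℕ) (H : Finset (Fin n) → ℝ) : Prop :=
  ∃ c : Finset (Fin n) → ℝ, Represents c H ∧ ∀ T : Finset (Fin n), m < T.card → c T = 0

/-- The states of energy `0`; for `0 ≤ H` and `H ∅ = 0` these are the states of least energy. -/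
def groundStates {n : ℕ} (H : Finset (Fin n) → ℝ) : Set (Finset (Fin n)) :=
  {S | H S = 0}

/-- The state `b` with its nonempty descendants of weight `m - 1`, `m - 3`, and so on. -/
def setA {n : ℕ} (m : ℕ) (b : Finset (Fin n)) : Set (Finset (Fin n)) :=
  {b} ∪ {d | d ⊆ b ∧ 1 ≤ d.card ∧ d.card + 1 ≤ m ∧ d.card + 1 ≡ m [MOD 2]}

/-- The nonempty descendants of `b` of weight `m`, `m - 2`, and so on. -/
def setB {n : ℕ} (m : ℕ) (b : Finset (Fin n)) : Set (Finset (Fin n)) :=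
  {d | d ⊆ b ∧ 1 ≤ d.card ∧ d.card ≤ m ∧ d.card ≡ m [MOD 2]}

/-- The coefficient of the energy of a state of weight `j` in the expansion of the energy of a
state of weight `k` in terms of the states of weight at most `m` below it. -/
def interpolationCoeff (k m j : ℕ) : ℝ :=
  if j ≤ m then (-1) ^ (m - j) * ((k - 1 - j).choose (m - j) : ℝ) else 0

theorem sum_antidiagonal_choose_mul_neg_one_pow (r M : ℕ) :
    ∑ p ∈ Finset.HasAntidiagonal.antidiagonal M,
      ((M + 1 + r).choose p.1 : ℤ) * ((-1) ^ p.2 * ((r + p.2).choose p.2 : ℤ)) = 1 := by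
  have h := Ring.add_choose_eq M (Commute.all ((M + 1 + r : ℕ) : ℤ) (-((r + 1 : ℕ) : ℤ)))
  have e : ((M + 1 + r : ℕ) : ℤ) + (-((r + 1 : ℕ) : ℤ)) = (M : ℕ) := by push_cast; ring
  rw [e, Ring.choose_natCast, Nat.choose_self, Nat.cast_one] at h
  refine Eq.trans ?_ h.symm
  refine Finset.sum_congr rfl fun p _ => ?_
  rw [Ring.choose_natCast, Ring.choose_neg]
  have e2 : ((r + 1 : ℕ) : ℤ) + (p.2 : ℤ) - 1 = ((r + p.2 : ℕ) : ℤ) := by push_cast; ring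
  rw [e2, Ring.choose_natCast, Int.negOnePow_def]
  simp [Units.smul_def]

theorem sum_choose_mul_interpolationCoeff {k m t : ℕ} (hk : m < k) (ht : t ≤ m) :
    ∑ i ∈ Finset.range (k - t + 1), ((k - t).choose i : ℝ) * interpolationCoeff k m (t + i) = 1 := by
  obtain ⟨M, rfl⟩ := Nat.exists_eq_add_of_le ht
  obtain ⟨r, rfl⟩ := Nat.exists_eq_add_of_le (Nat.succ_le_of_lt hk)
  have hK : (t + M).succ + r - t = M + 1 + r := by omega
  rw [hK]
  have hsub : Finset.range (M + 1) ⊆ Finset.range (M + 1 + r + 1) :=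
    Finset.range_subset_range.2 (by omega)
  rw [← Finset.sum_subset hsub]
  · have h := sum_antidiagonal_choose_mul_neg_one_pow r M
    rw [Finset.Nat.sum_antidiagonal_eq_sum_range_succ_mk] at h
    have h' := congrArg (Int.cast : ℤ → ℝ) h
    push_cast at h'
    rw [← h']
    refine Finset.sum_congr rfl fun i hi => ?_
    have hi' : i ≤ M := by simpa [Nat.lt_succ_iff] using hi
    have e1 : t + M - (t + i) = M - i := by omega
    have e2 : (t + M).succ + r - 1 - (t + i) = r + (M - i) := by omega
    rw [interpolationCoeff, if_pos (by omega), e1, e2]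
  · intro i _ hi
    have hi' : ¬ i ≤ M := by simpa [Nat.lt_succ_iff] using hi
    rw [interpolationCoeff, if_neg (by omega), mul_zero]

theorem sum_Icc_apply_card {α : Type*} [DecidableEq α] {T b : Finset α} (h : T ⊆ b) (g : ℕ → ℝ) :
    ∑ d ∈ Finset.Icc T b, g d.card =
      ∑ i ∈ Finset.range (b.card - T.card + 1),
        ((b.card - T.card).choose i : ℝ) * g (T.card + i) := by
  rw [Finset.Icc_eq_image_powerset h, Finset.sum_image]
  · rw [← Finset.card_sdiff_of_subset h]
    have := Finset.sum_powerset_apply_card (fun i => g (T.card + i)) (x := b \ T)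
    simp only [nsmul_eq_mul] at this
    rw [← this]
    refine Finset.sum_congr rfl fun e he => ?_
    rw [Finset.card_union_of_disjoint]
    exact Finset.disjoint_sdiff.mono_right (Finset.mem_powerset.1 he)
  · intro x hx y hy hxy
    have hx' : Disjoint T x :=
      Finset.disjoint_sdiff.mono_right (Finset.mem_powerset.1 (Finset.mem_coe.1 hx))
    have hy' : Disjoint T y :=
      Finset.disjoint_sdiff.mono_right (Finset.mem_powerset.1 (Finset.mem_coe.1 hy))
    rw [← Finset.union_sdiff_cancel_left hx', ← Finset.union_sdiff_cancel_left hy']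
    exact congrArg (· \ T) hxy

/-- The energy of a state of weight above `m` is determined by the states of weight at most `m`
below it. -/
theorem IsBody.eq_sum_interpolationCoeff {n m : ℕ} {H : Finset (Fin n) → ℝ} (hbody : IsBody m H)
    {b : Finset (Fin n)} (hb : m < b.card) :
    H b = ∑ d ∈ b.powerset, interpolationCoeff b.card m d.card * H d := by
  obtain ⟨c, hc, hm⟩ := hbody
  simp_rw [hc _, Finset.mul_sum]
  rw [Finset.sum_comm' (t' := b.powerset) (s' := fun T => Finset.Icc T b)]
  · refine Finset.sum_congr rfl fun T hT => ?_
    rw [← Finset.sum_mul]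
    rcases le_or_gt T.card m with h | h
    · rw [sum_Icc_apply_card (Finset.mem_powerset.1 hT), sum_choose_mul_interpolationCoeff hb h,
        one_mul]
    · rw [hm T h, mul_zero]
  · intro d T
    simp only [Finset.mem_powerset, Finset.mem_Icc]
    exact ⟨fun h => ⟨⟨h.2, h.1⟩, h.2.trans h.1⟩, fun h => ⟨h.1.2, h.1.1⟩⟩

theorem interpolationCoeff_pos {k m j : ℕ} (hk : m < k) (hj : j ≤ m) (h : j ≡ m [MOD 2]) :
    0 < interpolationCoeff k m j := by
  have he : Even (m - j) := even_iff_two_dvd.2 ((Nat.modEq_iff_dvd' hj).1 h)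
  rw [interpolationCoeff, if_pos hj, he.neg_one_pow, one_mul]
  exact_mod_cast Nat.choose_pos (by omega)

theorem interpolationCoeff_neg {k m j : ℕ} (hk : m < k) (hj : j + 1 ≤ m)
    (h : j + 1 ≡ m [MOD 2]) : interpolationCoeff k m j < 0 := by
  have ho : Odd (m - j) := by
    have : Even (m - (j + 1)) := even_iff_two_dvd.2 ((Nat.modEq_iff_dvd' hj).1 h)
    have e : m - j = m - (j + 1) + 1 := by omega
    rw [e]
    exact this.add_one
  rw [interpolationCoeff, if_pos (by omega), ho.neg_one_pow, neg_one_mul, neg_lt_zero]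
  exact_mod_cast Nat.choose_pos (by omega)

theorem ground_state_parity_constraint (n m : ℕ) (H : Finset (Fin n) → ℝ)
    (hbody : IsBody m H) (hnonneg : ∀ S : Finset (Fin n), 0 ≤ H S) (hzero : H ∅ = 0)
    (b : Finset (Fin n)) (hb : m < b.card) :
    setA m b ⊆ groundStates H ↔ setB m b ⊆ groundStates H := by
  have key := hbody.eq_sum_interpolationCoeff hb
  have cases (d : Finset (Fin n)) : d = ∅ ∨ m < d.card ∨
      (1 ≤ d.card ∧ d.card ≤ m ∧ d.card ≡ m [MOD 2]) ∨
      (1 ≤ d.card ∧ d.card + 1 ≤ m ∧ d.card + 1 ≡ m [MOD 2]) := by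
    rw [← Finset.card_eq_zero]
    simp only [Nat.ModEq]
    omega
  constructor
  · intro hA d ⟨hd, _, hdm, hpar⟩
    have hterm : ∀ e ∈ b.powerset, 0 ≤ interpolationCoeff b.card m e.card * H e := by
      intro e he
      rcases cases e with rfl | h | ⟨_, h1, h2⟩ | h
      · simp [hzero]
      · simp [interpolationCoeff, h.not_ge]
      · exact mul_nonneg (interpolationCoeff_pos hb h1 h2).le (hnonneg e)
      · have : H e = 0 := hA (Or.inr ⟨Finset.mem_powerset.1 he, h⟩)
        simp [this]
    have hHb : H b = 0 := hA (Or.inl rfl)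
    have hz := (Finset.sum_eq_zero_iff_of_nonneg hterm).1 (key.symm.trans hHb) d
      (Finset.mem_powerset.2 hd)
    exact (mul_eq_zero.1 hz).resolve_left (interpolationCoeff_pos hb hdm hpar).ne'
  · intro hB
    have hterm : ∀ e ∈ b.powerset, interpolationCoeff b.card m e.card * H e ≤ 0 := by
      intro e he
      rcases cases e with rfl | h | h | ⟨_, h1, h2⟩
      · simp [hzero]
      · simp [interpolationCoeff, h.not_ge]
      · have : H e = 0 := hB ⟨Finset.mem_powerset.1 he, h⟩
        simp [this]
      · exact mul_nonpos_of_nonpos_of_nonneg (interpolationCoeff_neg hb h1 h2).le (hnonneg e)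
    have hHb : H b = 0 := le_antisymm (key.trans_le (Finset.sum_nonpos hterm)) (hnonneg b)
    rintro d (rfl | ⟨hd, _, hdm, hpar⟩)
    · exact hHb
    · have hz := (Finset.sum_eq_zero_iff_of_nonpos hterm).1 (key.symm.trans hHb) d
        (Finset.mem_powerset.2 hd)
      exact (mul_eq_zero.1 hz).resolve_left (interpolationCoeff_neg hb hdm hpar).ne
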